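/- arXiv:2306.02215 — 3 statements merged into one kernel-verified Lean document; each statement's English description precedes it below -/
import Mathlib

section
/- Let g, h : (0, ∞) → ℝ with g' and h' nondecreasing, h' ≥ 0, and x ↦ h'(x)/x nondecreasing on (0, ∞). Let μ₊ > 0 satisfy g'(μ₊) + h'(μ₊)/μ₊ ≥ 0. Let I : [0, ∞) → [0, ∞) and let μ : [0, ∞) → (0, ∞) be differentiable with μ'(t) = −[ g'(μ(t)) + h'(μ(t))·( I(t) + 1/μ(t) ) ] for all t ≥ 0. If μ(0) ≤ μ₊, then μ(t) ≤ μ₊ for all t ≥ 0. -/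
theorem upper_invariance (g h : ℝ → ℝ)
    (hg' : MonotoneOn (deriv g) (Set.Ioi (0 : ℝ)))
    (hh' : MonotoneOn (deriv h) (Set.Ioi (0 : ℝ)))
    (hh'pos : ∀ x ∈ Set.Ioi (0 : ℝ), 0 ≤ deriv h x)
    (hh'div : MonotoneOn (fun x => deriv h x / x) (Set.Ioi (0 : ℝ)))
    (μp : ℝ) (hμp : 0 < μp)
    (hμp' : 0 ≤ deriv g μp + deriv h μp / μp)
    (I : ℝ → ℝ) (hI : ∀ t ≥ (0 : ℝ), 0 ≤ I t)
    (μ : ℝ → ℝ) (hμpos : ∀ t ≥ (0 : ℝ), 0 < μ t)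
    (hμ : ∀ t ≥ (0 : ℝ),
      HasDerivAt μ (-(deriv g (μ t) + deriv h (μ t) * (I t + 1 / μ t))) t)
    (h0 : μ 0 ≤ μp) :
    ∀ t ≥ (0 : ℝ), μ t ≤ μp := by
  have key : ∀ t ≥ (0 : ℝ), μp ≤ μ t →
      -(deriv g (μ t) + deriv h (μ t) * (I t + 1 / μ t)) ≤ 0 := by
    intro t ht hle
    have h1 := hg' hμp (hμpos t ht) hle
    have h2 : deriv h μp / μp ≤ deriv h (μ t) / μ t := hh'div hμp (hμpos t ht) hle
    have h3 := mul_nonneg (hh'pos _ (hμpos t ht)) (hI t ht)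
    have h4 : deriv h (μ t) * (I t + 1 / μ t)
        = deriv h (μ t) * I t + deriv h (μ t) / μ t := by ring
    linarith
  intro t ht
  have step : ∀ ε > (0 : ℝ), μ t ≤ μp + ε * t := by
    intro ε hε
    refine image_le_of_deriv_right_lt_deriv_boundary (f := μ) (a := 0) (b := t)
      (f' := fun t => -(deriv g (μ t) + deriv h (μ t) * (I t + 1 / μ t)))
      (B := fun s => μp + ε * s) (B' := fun _ => ε) ?_ ?_ ?_ ?_ ?_ ⟨ht, le_refl t⟩
    · exact fun s hs => (hμ s hs.1).continuousAt.continuousWithinAt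
    · exact fun s hs => (hμ s hs.1).hasDerivWithinAt
    · simpa using h0
    · intro s
      simpa using ((hasDerivAt_id s).const_mul ε).const_add μp
    · intro s hs heq
      have hs0 : 0 ≤ ε * s := mul_nonneg hε.le hs.1
      have := key s hs.1 (by rw [heq]; linarith)
      exact lt_of_le_of_lt this hε
  by_contra hlt
  push Not at hlt
  have h5 := step ((μ t - μp) / (2 * (t + 1))) (by apply div_pos <;> linarith)
  have h6 : (μ t - μp) / (2 * (t + 1)) * (t + 1) = (μ t - μp) / 2 := by
    field_simp
  have h7 : 0 < (μ t - μp) / (2 * (t + 1)) := by apply div_pos <;> linarith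
  linarith
end

section
/- Let λ ≥ 0 and g, h : (0, ∞) → ℝ with g' and h' nondecreasing, h' ≥ 0, and x ↦ h'(x)/x nondecreasing on (0, ∞). Let μ₋ > 0 satisfy g'(μ₋) + h'(μ₋)·(λ + 1/μ₋) ≤ 0. Let I : [0, ∞) → [0, λ] and let μ : [0, ∞) → (0, ∞) be differentiable with μ'(t) = −[ g'(μ(t)) + h'(μ(t))·( I(t) + 1/μ(t) ) ] for all t ≥ 0. If μ(0) ≥ μ₋, then μ(t) ≥ μ₋ for all t ≥ 0. -/
theorem lower_invariance (lam : ℝ) (hlam : 0 ≤ lam) (g h : ℝ → ℝ)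
    (hg' : MonotoneOn (deriv g) (Set.Ioi (0 : ℝ)))
    (hh' : MonotoneOn (deriv h) (Set.Ioi (0 : ℝ)))
    (hh'pos : ∀ x ∈ Set.Ioi (0 : ℝ), 0 ≤ deriv h x)
    (hh'div : MonotoneOn (fun x => deriv h x / x) (Set.Ioi (0 : ℝ)))
    (μm : ℝ) (hμm : 0 < μm)
    (hμm' : deriv g μm + deriv h μm * (lam + 1 / μm) ≤ 0)
    (I : ℝ → ℝ) (hI : ∀ t ≥ (0 : ℝ), I t ∈ Set.Icc (0 : ℝ) lam)
    (μ : ℝ → ℝ) (hμpos : ∀ t ≥ (0 : ℝ), 0 < μ t)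
    (hμ : ∀ t ≥ (0 : ℝ),
      HasDerivAt μ (-(deriv g (μ t) + deriv h (μ t) * (I t + 1 / μ t))) t)
    (h0 : μm ≤ μ 0) :
    ∀ t ≥ (0 : ℝ), μm ≤ μ t := by
  intro T hT
  have key : ∀ t ≥ (0 : ℝ), μ t ≤ μm →
      0 ≤ -(deriv g (μ t) + deriv h (μ t) * (I t + 1 / μ t)) := by
    intro t ht hle
    have hp := hμpos t ht
    have h1 := hg' hp hμm hle
    have h2 := hh' hp hμm hle
    have h3 : deriv h (μ t) / μ t ≤ deriv h μm / μm := hh'div hp hμm hle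
    have h4 := hh'pos _ hp
    have h5 : deriv h (μ t) * I t ≤ deriv h μm * lam :=
      mul_le_mul h2 (hI t ht).2 (hI t ht).1 (h4.trans h2)
    rw [mul_add, mul_one_div] at hμm' ⊢
    linarith
  have main : ∀ ε > (0 : ℝ), -μ T ≤ -μm + ε * T := by
    intro ε hε
    have hB : ∀ x : ℝ, HasDerivAt (fun t : ℝ => -μm + ε * t) ε x := by
      intro x
      simpa using ((hasDerivAt_id x).const_mul ε).const_add (-μm)
    refine image_le_of_deriv_right_lt_deriv_boundary' (f := fun t => -μ t) (a := 0) (b := T)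
      (f' := fun t => - -(deriv g (μ t) + deriv h (μ t) * (I t + 1 / μ t)))
      (B := fun t => -μm + ε * t) (B' := fun _ => ε) ?_ ?_ ?_ ?_ ?_ ?_ ⟨hT, le_rfl⟩
    · intro x hx
      exact (hμ x hx.1).neg.continuousAt.continuousWithinAt
    · intro x hx
      exact (hμ x hx.1).neg.hasDerivWithinAt
    · simpa using h0
    · intro x _
      exact (hB x).continuousAt.continuousWithinAt
    · intro x _
      exact (hB x).hasDerivWithinAt
    · intro x hx hEq
      have hEq' : -μ x = -μm + ε * x := hEq
      have := key x hx.1 (by nlinarith [mul_nonneg hε.le hx.1])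
      show - -(deriv g (μ x) + deriv h (μ x) * (I x + 1 / μ x)) < ε
      linarith
  by_contra hlt
  push Not at hlt
  have hT1 : 0 < T + 1 := by linarith
  have h1 := main ((μm - μ T) / (T + 1)) (div_pos (by linarith) hT1)
  have h2 : (μm - μ T) / (T + 1) * (T + 1) = μm - μ T := div_mul_cancel₀ _ hT1.ne'
  have h3 : 0 < (μm - μ T) / (T + 1) := div_pos (by linarith) hT1
  nlinarith
end

section
/- Let 0 < μ₋ ≤ μ₊, σ_g > 0, σ_h > 0, ε ≥ 0, and let g, h : ℝ → ℝ be twice differentiable on [μ₋, μ₊] with g''(x) ≥ σ_g and h''(x) ≥ σ_h for all x ∈ [μ₋, μ₊], with h'(x) ≥ 0 and x ↦ h'(x)/x nondecreasing on [μ₋, μ₊]; let H := sup over x ∈ [μ₋, μ₊] of h'(x). Let κ : [0, ∞) → [0, ∞), let E₁, E₂ : [0, ∞) → ℝ satisfy |E_i(t) − κ(t)| ≤ ε for all t ≥ 0 and i = 1, 2, and let μ₁, μ₂ : [0, ∞) → [μ₋, μ₊] be differentiable with μ_i'(t) = −g'(μ_i(t)) − h'(μ_i(t))·( E_i(t) +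 1/μ_i(t) ) for all t ≥ 0 and i = 1, 2. Then |μ₁(t) − μ₂(t)| ≤ |μ₁(0) − μ₂(0)|·e^{−σ_g t} + 2εH/σ_g for all t ≥ 0. -/
lemma aux_gronwall (σ C : ℝ) (hσ : 0 < σ) (hC : 0 ≤ C) (d d' : ℝ → ℝ)
    (hd : ∀ t ≥ (0 : ℝ), HasDerivAt d (d' t) t)
    (hb : ∀ t ≥ (0 : ℝ), 0 ≤ d t → d' t ≤ -σ * d t + C) :
    ∀ t ≥ (0 : ℝ), d t ≤ |d 0| * Real.exp (-σ * t) + C / σ := by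
  intro t ht
  refine le_of_forall_pos_le_add fun η hη => ?_
  have hB : ∀ x, HasDerivAt (fun s => |d 0| * Real.exp (-σ * s) + C / σ + η)
      (|d 0| * (Real.exp (-σ * x) * (-σ))) x := by
    intro x
    have h1 : HasDerivAt (fun s : ℝ => -σ * s) (-σ) x := by
      simpa using (hasDerivAt_id x).const_mul (-σ)
    exact ((h1.exp.const_mul |d 0|).add_const (C / σ)).add_const η
  have hCσ : 0 ≤ C / σ := div_nonneg hC hσ.le
  refine image_le_of_deriv_right_lt_deriv_boundary (f := d) (f' := d') (a := 0) (b := t)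
    (fun x hx => (hd x hx.1).continuousAt.continuousWithinAt)
    (fun x hx => (hd x hx.1).hasDerivWithinAt) ?_ hB ?_ ⟨ht, le_rfl⟩
  · have := le_abs_self (d 0)
    simp only [mul_zero, Real.exp_zero, mul_one]
    linarith
  · intro x hx he
    have h0 : 0 ≤ |d 0| * Real.exp (-σ * x) := by positivity
    have h1 := hb x hx.1 (by rw [he]; linarith)
    have h2 : σ * (C / σ) = C := by field_simp
    have h3 := mul_pos hσ hη
    rw [he] at h1
    nlinarith

lemma aux_drift (μm μp σg σh ε : ℝ)
    (hμm : 0 < μm) (hσh : 0 < σh) (hε : 0 ≤ ε)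
    (g h : ℝ → ℝ)
    (hg2 : ∀ x ∈ Set.Icc μm μp, DifferentiableAt ℝ (deriv g) x)
    (hg'' : ∀ x ∈ Set.Icc μm μp, σg ≤ deriv (deriv g) x)
    (hh2 : ∀ x ∈ Set.Icc μm μp, DifferentiableAt ℝ (deriv h) x)
    (hh'' : ∀ x ∈ Set.Icc μm μp, σh ≤ deriv (deriv h) x)
    (hh'pos : ∀ x ∈ Set.Icc μm μp, 0 ≤ deriv h x)
    (hh'div : MonotoneOn (fun x => deriv h x / x) (Set.Icc μm μp))
    (H : ℝ) (hH : IsLUB ((deriv h) '' Set.Icc μm μp) H)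
    (k e₁ e₂ x y : ℝ) (hk : 0 ≤ k) (he₁ : |e₁ - k| ≤ ε) (he₂ : |e₂ - k| ≤ ε)
    (hx : x ∈ Set.Icc μm μp) (hy : y ∈ Set.Icc μm μp) (hxy : 0 ≤ x - y) :
    (-deriv g x - deriv h x * (e₁ + 1 / x)) - (-deriv g y - deriv h y * (e₂ + 1 / y))
      ≤ -σg * (x - y) + 2 * ε * H := by
  have key : ∀ (f : ℝ → ℝ) (σ : ℝ), (∀ x ∈ Set.Icc μm μp, DifferentiableAt ℝ f x) →
      (∀ x ∈ Set.Icc μm μp, σ ≤ deriv f x) → σ * (x - y) ≤ f x - f y := by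
    intro f σ h1 h2
    exact (convex_Icc μm μp).mul_sub_le_image_sub_of_le_deriv
      (fun z hz => (h1 z hz).continuousAt.continuousWithinAt)
      (fun z hz => (h1 z (interior_subset hz)).differentiableWithinAt)
      (fun z hz => h2 z (interior_subset hz)) y hy x hx (by linarith)
  have kg := key _ _ hg2 hg''
  have kh := key _ _ hh2 hh''
  have kd : deriv h y / y ≤ deriv h x / x := hh'div hy hx (by linarith)
  have hHx : deriv h x ≤ H := hH.1 ⟨x, hx, rfl⟩
  have hHy : deriv h y ≤ H := hH.1 ⟨y, hy, rfl⟩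
  have px := hh'pos x hx
  have py := hh'pos y hy
  rw [abs_le] at he₁ he₂
  have m1 : 0 ≤ k * (deriv h x - deriv h y) :=
    mul_nonneg hk (le_trans (mul_nonneg hσh.le hxy) kh)
  have m2 : 0 ≤ deriv h x * (e₁ - k + ε) := mul_nonneg px (by linarith)
  have m3 : 0 ≤ deriv h y * (ε - (e₂ - k)) := mul_nonneg py (by linarith)
  have m4 := mul_le_mul_of_nonneg_left hHx hε
  have m5 := mul_le_mul_of_nonneg_left hHy hε
  have r1 : deriv h x * (e₁ + 1 / x) = deriv h x * e₁ + deriv h x / x := by ring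
  have r2 : deriv h y * (e₂ + 1 / y) = deriv h y * e₂ + deriv h y / y := by ring
  rw [r1, r2]
  linarith

theorem rates_contract (μm μp σg σh ε : ℝ)
    (hμm : 0 < μm) (hμmp : μm ≤ μp) (hσg : 0 < σg) (hσh : 0 < σh) (hε : 0 ≤ ε)
    (g h : ℝ → ℝ)
    (hg1 : ∀ x ∈ Set.Icc μm μp, DifferentiableAt ℝ g x)
    (hg2 : ∀ x ∈ Set.Icc μm μp, DifferentiableAt ℝ (deriv g) x)
    (hg'' : ∀ x ∈ Set.Icc μm μp, σg ≤ deriv (deriv g) x)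
    (hh1 : ∀ x ∈ Set.Icc μm μp, DifferentiableAt ℝ h x)
    (hh2 : ∀ x ∈ Set.Icc μm μp, DifferentiableAt ℝ (deriv h) x)
    (hh'' : ∀ x ∈ Set.Icc μm μp, σh ≤ deriv (deriv h) x)
    (hh'pos : ∀ x ∈ Set.Icc μm μp, 0 ≤ deriv h x)
    (hh'div : MonotoneOn (fun x => deriv h x / x) (Set.Icc μm μp))
    (H : ℝ) (hH : IsLUB ((deriv h) '' Set.Icc μm μp) H)
    (κ : ℝ → ℝ) (hκ : ∀ t ≥ (0 : ℝ), 0 ≤ κ t)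
    (E₁ E₂ : ℝ → ℝ)
    (hE₁ : ∀ t ≥ (0 : ℝ), |E₁ t - κ t| ≤ ε)
    (hE₂ : ∀ t ≥ (0 : ℝ), |E₂ t - κ t| ≤ ε)
    (μ₁ μ₂ : ℝ → ℝ)
    (hμ₁mem : ∀ t ≥ (0 : ℝ), μ₁ t ∈ Set.Icc μm μp)
    (hμ₂mem : ∀ t ≥ (0 : ℝ), μ₂ t ∈ Set.Icc μm μp)
    (hμ₁ : ∀ t ≥ (0 : ℝ),
      HasDerivAt μ₁ (-deriv g (μ₁ t) - deriv h (μ₁ t) * (E₁ t + 1 / μ₁ t)) t)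
    (hμ₂ : ∀ t ≥ (0 : ℝ),
      HasDerivAt μ₂ (-deriv g (μ₂ t) - deriv h (μ₂ t) * (E₂ t + 1 / μ₂ t)) t) :
    ∀ t ≥ (0 : ℝ),
      |μ₁ t - μ₂ t| ≤ |μ₁ 0 - μ₂ 0| * Real.exp (-σg * t) + 2 * ε * H / σg := by
  intro t ht
  have hH0 : 0 ≤ H := (hh'pos μm ⟨le_rfl, hμmp⟩).trans (hH.1 ⟨μm, ⟨le_rfl, hμmp⟩, rfl⟩)
  have hC : 0 ≤ 2 * ε * H := by positivity
  have A := aux_gronwall σg (2 * ε * H) hσg hC (fun s => μ₁ s - μ₂ s) _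
    (fun s hs => (hμ₁ s hs).sub (hμ₂ s hs))
    (fun s hs h0 => aux_drift μm μp σg σh ε hμm hσh hε g h hg2 hg'' hh2 hh'' hh'pos hh'div H hH
      (κ s) (E₁ s) (E₂ s) _ _ (hκ s hs) (hE₁ s hs) (hE₂ s hs) (hμ₁mem s hs) (hμ₂mem s hs) h0) t ht
  have B := aux_gronwall σg (2 * ε * H) hσg hC (fun s => μ₂ s - μ₁ s) _
    (fun s hs => (hμ₂ s hs).sub (hμ₁ s hs))
    (fun s hs h0 => aux_drift μm μp σg σh ε hμm hσh hε g h hg2 hg'' hh2 hh'' hh'pos hh'div H hH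
      (κ s) (E₂ s) (E₁ s) _ _ (hκ s hs) (hE₂ s hs) (hE₁ s hs) (hμ₂mem s hs) (hμ₁mem s hs) h0) t ht
  rw [abs_sub_comm (μ₂ 0)] at B
  exact abs_le.2 ⟨by linarith, A⟩
end
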